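/- arXiv:2412.12900 — 4 statements merged into one kernel-verified Lean document; each statement's English description precedes it below -/
import Mathlib

section
/- An N×N real matrix H commutes with each of S_1, …, S_L (i.e., H S_l = S_l H for all 1 ≤ l ≤ L) if and only if H is a polynomial filter of S_1, …, S_L, i.e., H = Σ_{(α_1,…,α_L)} h_{α_1,…,α_L} S_1^{α_1}⋯S_L^{α_L} for some real multivariate polynomial h with the sum taken over a finite subset of ℤ_+^L. -/
open Matrix

/-- `S^α = S 0 ^ α 0 * S 1 ^ α 1 * ⋯ * S (L-1) ^ α (L-1)`. -/
def Spow {N L : ℕ} (S : Fin L → Matrix (Fin N) (Fin N) ℝ) (α : Fin L → ℕ) :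
    Matrix (Fin N) (Fin N) ℝ :=
  (List.ofFn fun l => S l ^ α l).prod

/-- Conjugation of diagonal matrices by an orthogonal matrix, as an algebra homomorphism. -/
def conjDiagonal {N : ℕ} (U : Matrix (Fin N) (Fin N) ℝ) (hU : Uᵀ * U = 1) (hU' : U * Uᵀ = 1) :
    (Fin N → ℝ) →ₐ[ℝ] Matrix (Fin N) (Fin N) ℝ :=
  AlgHom.ofLinearMap
    { toFun := fun d => U * diagonal d * Uᵀ
      map_add' := fun d e => by rw [← add_mul, ← mul_add, diagonal_add]; rfl
      map_smul' := fun c d => by simp [diagonal_smul] }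
    (by simp [hU'])
    (fun d e => by
      change U * diagonal (d * e) * Uᵀ = U * diagonal d * Uᵀ * (U * diagonal e * Uᵀ)
      rw [show U * diagonal d * Uᵀ * (U * diagonal e * Uᵀ)
        = U * diagonal d * (Uᵀ * U) * diagonal e * Uᵀ by simp only [Matrix.mul_assoc],
        hU, Matrix.mul_one, Matrix.mul_assoc U (diagonal d), diagonal_mul_diagonal]
      rfl)

theorem conjDiagonal_apply {N : ℕ} (U : Matrix (Fin N) (Fin N) ℝ) (hU : Uᵀ * U = 1)
    (hU' : U * Uᵀ = 1) (d : Fin N → ℝ) :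
    conjDiagonal U hU hU' d = U * diagonal d * Uᵀ := rfl

theorem Spow_algHom {N L : ℕ} (φ : (Fin N → ℝ) →ₐ[ℝ] Matrix (Fin N) (Fin N) ℝ)
    (lam : Fin L → Fin N → ℝ) (α : Fin L → ℕ) :
    Spow (fun l => φ (lam l)) α = φ (∏ l, lam l ^ α l) := by
  rw [Spow, ← List.prod_ofFn, map_list_prod, List.map_ofFn]
  congr 2
  ext1 l
  simp

/-- Multivariate polynomials interpolate arbitrary values at finitely many distinct points. -/
theorem exists_mvPolynomial_eval_eq {K ι σ : Type*} [Field K] [Fintype ι]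
    (x : ι → σ → K) (hx : Function.Injective x) (d : ι → K) :
    ∃ f : MvPolynomial σ K, ∀ n, MvPolynomial.eval (x n) f = d n := by
  classical
  have hsep : ∀ n m : ι, ∃ g : MvPolynomial σ K, n ≠ m →
      MvPolynomial.eval (x n) g = 1 ∧ MvPolynomial.eval (x m) g = 0 := by
    intro n m
    by_cases h : n = m
    · exact ⟨0, fun h' => absurd h h'⟩
    · obtain ⟨l, hl⟩ := Function.ne_iff.mp (hx.ne h)
      exact ⟨MvPolynomial.C (x n l - x m l)⁻¹ * (MvPolynomial.X l - MvPolynomial.C (x m l)),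
        fun _ => by simp [inv_mul_cancel₀ (sub_ne_zero.mpr hl)]⟩
  choose g hg using hsep
  refine ⟨∑ n, MvPolynomial.C (d n) * ∏ m ∈ Finset.univ.erase n, g n m, fun k => ?_⟩
  rw [map_sum, Finset.sum_eq_single k]
  · rw [map_mul, map_prod, Finset.prod_eq_one, MvPolynomial.eval_C, mul_one]
    exact fun m hm => (hg k m (Finset.ne_of_mem_erase hm).symm).1
  · intro n _ hn
    rw [map_mul, map_prod, Finset.prod_eq_zero (i := k), mul_zero]
    · simp [hn.symm]
    · exact (hg n k hn).2
  · simp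

/-- A matrix commuting with a family of diagonal matrices that separates the indices is
diagonal. -/
theorem isDiag_of_commute_diagonal {K ι σ : Type*} [Field K] [Fintype ι] [DecidableEq ι]
    (lam : σ → ι → K) (hlam : ∀ n m, (∀ l, lam l n = lam l m) → n = m) (D : Matrix ι ι K)
    (hD : ∀ l, D * diagonal (lam l) = diagonal (lam l) * D) : D.IsDiag := by
  intro i j hij
  by_contra h
  refine hij (hlam i j fun l => ?_)
  have := congrFun (congrFun (hD l) i) j
  rw [mul_diagonal, diagonal_mul, mul_comm] at this
  exact (mul_right_cancel₀ h this).symm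

/-- An `N×N` real matrix `H` commutes with each of the graph shifts `S 1, …, S L`
if and only if `H` is a polynomial filter of `S 1, …, S L`. -/
theorem stmt0 {N L : ℕ} (hN : 1 ≤ N) (hL : 1 ≤ L)
    (S : Fin L → Matrix (Fin N) (Fin N) ℝ)
    (U : Matrix (Fin N) (Fin N) ℝ)
    (lam : Fin L → Fin N → ℝ)
    (hsymm : ∀ l, (S l)ᵀ = S l)
    (hcomm : ∀ l l', S l * S l' = S l' * S l)
    (hU : Uᵀ * U = 1 ∧ U * Uᵀ = 1)
    (hdiag : ∀ l, S l = U * Matrix.diagonal (lam l) * Uᵀ)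
    (hspec : ∀ n m : Fin N, (∀ l, lam l n = lam l m) → n = m)
    (H : Matrix (Fin N) (Fin N) ℝ) :
    (∀ l, H * S l = S l * H) ↔
      ∃ (F : Finset (Fin L → ℕ)) (h : (Fin L → ℕ) → ℝ),
        H = ∑ α ∈ F, h α • Spow S α := by
  obtain ⟨hU₁, hU₂⟩ := hU
  have hS : S = fun l => conjDiagonal U hU₁ hU₂ (lam l) := funext hdiag
  constructor
  · intro hH
    have hcancel (A : Matrix (Fin N) (Fin N) ℝ) : Uᵀ * (U * A) = A := by
      rw [← Matrix.mul_assoc, hU₁, Matrix.one_mul]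
    have hD : (Uᵀ * H * U).IsDiag := by
      refine isDiag_of_commute_diagonal lam hspec _ fun l => ?_
      have h := congrArg (fun A => Uᵀ * A * U) (hH l)
      simpa only [hdiag, Matrix.mul_assoc, hcancel, hU₁, Matrix.mul_one] using h
    have hH' : H = conjDiagonal U hU₁ hU₂ (Uᵀ * H * U).diag := by
      rw [conjDiagonal_apply, hD.diagonal_diag]
      simp only [Matrix.mul_assoc, hU₂, Matrix.mul_one]
      rw [← Matrix.mul_assoc, hU₂, Matrix.one_mul]
    obtain ⟨f, hf⟩ := exists_mvPolynomial_eval_eq (fun n l => lam l n)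
      (fun n m h => hspec n m (congrFun h)) (Uᵀ * H * U).diag
    refine ⟨f.support.map Finsupp.equivFunOnFinite.toEmbedding,
      fun α => f.coeff (Finsupp.equivFunOnFinite.symm α), ?_⟩
    rw [hH', hS, Finset.sum_map]
    simp only [Spow_algHom, ← map_smul, ← map_sum]
    congr 1
    ext n
    rw [← hf, MvPolynomial.eval_eq']
    simp
  · rintro ⟨F, h, rfl⟩ l
    subst hS
    simp only [Spow_algHom, ← map_smul, ← map_sum, ← map_mul, mul_comm]
end

section
/- If a linear subspace H of ℝ^N is shift-invariant, then H equals the bandlimited space B_Ω with Ω = ∪_{x ∈ H} supp x̂ (the union over x ∈ H of the supports of their graph Fourier transforms), and moreover the cardinality of Ω equals the dimension of H: #Ω = dim H. -/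
open Matrix

section DiagonalInvariant

variable {ι κ 𝕜 : Type*} [Fintype ι] [Field 𝕜]

/-- A subspace invariant under multiplication by functions that separate the indices is invariant
under the coordinate projections. -/
theorem Submodule.single_apply_mem_of_mul_mem [DecidableEq ι] {K : Submodule 𝕜 (ι → 𝕜)}
    {lam : κ → ι → 𝕜} (hsep : ∀ n m, (∀ l, lam l n = lam l m) → n = m)
    (hK : ∀ y ∈ K, ∀ l, lam l * y ∈ K) {y : ι → 𝕜} (hy : y ∈ K) (n : ι) :
    Pi.single n (y n) ∈ K := by
  have key : ∀ s : Finset ι, n ∉ s → ∃ z ∈ K, z n = y n ∧ ∀ m ∈ s, z m = 0 := by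
    intro s
    induction s using Finset.induction_on with
    | empty => exact fun _ => ⟨y, hy, rfl, by simp⟩
    | insert m s _ ih =>
      intro hn
      rw [Finset.mem_insert, not_or] at hn
      obtain ⟨z, hz, hzn, hzs⟩ := ih hn.2
      obtain ⟨l, hl⟩ : ∃ l, lam l n ≠ lam l m := by
        by_contra! h
        exact hn.1 (hsep n m h)
      refine ⟨(lam l n - lam l m)⁻¹ • (lam l * z - lam l m • z),
        K.smul_mem _ (K.sub_mem (hK z hz l) (K.smul_mem _ hz)), ?_, ?_⟩
      · have := sub_ne_zero.2 hl
        simp only [Pi.smul_apply, Pi.sub_apply, Pi.mul_apply, smul_eq_mul, hzn]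
        field_simp
      · intro k hk
        rcases Finset.mem_insert.1 hk with rfl | hk
        · simp
        · simp [hzs k hk]
  obtain ⟨z, hz, hzn, hz0⟩ := key (Finset.univ.erase n) (Finset.notMem_erase _ _)
  convert hz using 1
  ext m
  rcases eq_or_ne m n with rfl | hm
  · simp [hzn]
  · simp [hm, hz0 m (Finset.mem_erase.2 ⟨hm, Finset.mem_univ m⟩)]

/-- A subspace invariant under the coordinate projections consists of all vectors supported in the
union of the supports of its elements. -/
theorem Submodule.eq_iInf_ker_proj_of_single_apply_mem [DecidableEq ι] {K : Submodule 𝕜 (ι → 𝕜)}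
    (hK : ∀ y ∈ K, ∀ n, Pi.single n (y n) ∈ K) :
    K = ⨅ n ∈ {n | ∃ y ∈ K, y n ≠ 0}ᶜ, LinearMap.ker (LinearMap.proj n : (ι → 𝕜) →ₗ[𝕜] 𝕜) := by
  ext x
  simp only [Submodule.mem_iInf, LinearMap.mem_ker, LinearMap.proj_apply]
  constructor
  · intro hx n hn
    by_contra h
    exact hn ⟨x, hx, h⟩
  · intro hx
    rw [← Finset.univ_sum_single x]
    refine K.sum_mem fun n _ => ?_
    by_cases hn : ∃ y ∈ K, y n ≠ 0
    · obtain ⟨y, hy, hyn⟩ := hn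
      have := K.smul_mem (x n / y n) (hK y hy n)
      rwa [← Pi.single_smul, smul_eq_mul, div_mul_cancel₀ _ hyn] at this
    · rw [hx n hn, Pi.single_zero]
      exact K.zero_mem

theorem Module.finrank_iInf_ker_proj_compl (s : Set ι) :
    Module.finrank 𝕜
      (⨅ n ∈ sᶜ, LinearMap.ker (LinearMap.proj n : (ι → 𝕜) →ₗ[𝕜] 𝕜) : Submodule 𝕜 (ι → 𝕜)) =
      s.ncard := by
  classical
  rw [(LinearMap.iInfKerProjEquiv 𝕜 (fun _ : ι => 𝕜) (disjoint_compl_right (a := s))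
    (by simp)).finrank_eq, Module.finrank_fintype_fun_eq_card, Set.ncard_eq_toFinset_card',
    Set.toFinset_card]

end DiagonalInvariant

/-- If a linear subspace `H` of `ℝ^N` is shift-invariant, then `H` equals the
bandlimited space `B_Ω` with `Ω = ⋃_{x ∈ H} supp x̂`, and `#Ω = dim H`. -/
theorem stmt4 {N L : ℕ} (hN : 1 ≤ N) (hL : 1 ≤ L)
    (S : Fin L → Matrix (Fin N) (Fin N) ℝ)
    (U : Matrix (Fin N) (Fin N) ℝ)
    (lam : Fin L → Fin N → ℝ)
    (hsymm : ∀ l, (S l)ᵀ = S l)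
    (hcomm : ∀ l l', S l * S l' = S l' * S l)
    (hU : Uᵀ * U = 1 ∧ U * Uᵀ = 1)
    (hdiag : ∀ l, S l = U * Matrix.diagonal (lam l) * Uᵀ)
    (hspec : ∀ n m : Fin N, (∀ l, lam l n = lam l m) → n = m)
    (H : Submodule ℝ (Fin N → ℝ))
    (hinv : ∀ x ∈ H, ∀ l, S l *ᵥ x ∈ H) :
    (∀ x, x ∈ H ↔ ∀ n ∉ {n : Fin N | ∃ y ∈ H, (Uᵀ *ᵥ y) n ≠ 0}, (Uᵀ *ᵥ x) n = 0) ∧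
      {n : Fin N | ∃ y ∈ H, (Uᵀ *ᵥ y) n ≠ 0}.ncard = Module.finrank ℝ H := by
  have hUU : ∀ x, U *ᵥ (Uᵀ *ᵥ x) = x := fun x => by rw [mulVec_mulVec, hU.2, one_mulVec]
  have hinj : Function.Injective Uᵀ.mulVecLin :=
    Function.LeftInverse.injective (g := fun y => U *ᵥ y) hUU
  set K := H.map Uᵀ.mulVecLin with hKdef
  have hmem : ∀ x, Uᵀ *ᵥ x ∈ K ↔ x ∈ H := fun x =>
    ⟨fun ⟨y, hy, hyx⟩ => hinj hyx ▸ hy, fun hx => ⟨x, hx, rfl⟩⟩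
  have hKmul : ∀ y ∈ K, ∀ l, lam l * y ∈ K := by
    rintro _ ⟨x, hx, rfl⟩ l
    refine ⟨S l *ᵥ x, hinv x hx l, ?_⟩
    rw [mulVecLin_apply, mulVecLin_apply, hdiag, mulVec_mulVec, ← Matrix.mul_assoc,
      ← Matrix.mul_assoc, hU.1, Matrix.one_mul, ← mulVec_mulVec]
    ext n
    rw [mulVec_diagonal, Pi.mul_apply]
  have hΩ : {n : Fin N | ∃ y ∈ H, (Uᵀ *ᵥ y) n ≠ 0} = {n | ∃ y ∈ K, y n ≠ 0} := by
    ext n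
    simp [hKdef, mulVec_transpose]
  have hK := Submodule.eq_iInf_ker_proj_of_single_apply_mem fun y hy n =>
    Submodule.single_apply_mem_of_mul_mem hspec hKmul hy n
  rw [hΩ]
  constructor
  · intro x
    rw [← hmem x]
    conv_lhs => rw [hK]
    simp only [Submodule.mem_iInf, LinearMap.mem_ker, LinearMap.proj_apply, Set.mem_compl_iff]
  · rw [← Module.finrank_iInf_ker_proj_compl (𝕜 := ℝ), ← hK]
    exact (Submodule.equivMapOfInjective _ hinj H).finrank_eq.symm
end

section
/- For every nonempty subset Ω ⊆ {1, …, N}, there exist a vector φ₀ ∈ B_Ω satisfying φ̂₀(n) ≠ 0 if and only if n ∈ Ω, and a vector d = (d_1, …, d_L) ∈ ℝ^L such that, setting T = Σ_{l=1}^L d_l S_l, the bandlimited space is generated by the first #Ω powers of T applied to φ₀: B_Ω = span{Tᵐ φ₀ : 0 ≤ m ≤ #Ω − 1}. -/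
open Matrix

/-- Finitely many pairwise distinct vectors are separated by a single linear functional. -/
theorem exists_injective_dotProduct {K ι : Type*} [Field K] [Infinite K] [Finite ι] {L : ℕ}
    {v : ι → Fin L → K} (hv : Function.Injective v) :
    ∃ d : Fin L → K, Function.Injective fun i => d ⬝ᵥ v i := by
  classical
  cases nonempty_fintype ι
  let p : ι → Polynomial K := fun i => ∑ l : Fin L, Polynomial.monomial (l : ℕ) (v i l)
  have coeff_p (i : ι) (l : Fin L) : (p i).coeff l = v i l := by
    simp [p, Polynomial.finsetSum_coeff, Polynomial.coeff_monomial, Fin.val_inj]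
  have hp : Function.Injective p := fun i j hij =>
    hv <| funext fun l => by rw [← coeff_p, ← coeff_p, hij]
  have hP : ∏ q ∈ (Finset.univ : Finset ι).offDiag, (p q.1 - p q.2) ≠ 0 :=
    Finset.prod_ne_zero_iff.2 fun q hq =>
      sub_ne_zero.2 <| hp.ne (Finset.mem_offDiag.1 hq).2.2
  obtain ⟨t, ht⟩ : ∃ t, (∏ q ∈ (Finset.univ : Finset ι).offDiag, (p q.1 - p q.2)).eval t ≠ 0 := by
    by_contra! h
    exact hP (Polynomial.funext fun t => by simpa using h t)
  rw [Polynomial.eval_prod, Finset.prod_ne_zero_iff] at ht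
  refine ⟨fun l => t ^ (l : ℕ), fun i j hij => ?_⟩
  by_contra hne
  refine ht (i, j) (by simp [hne]) ?_
  have eval_p (i : ι) : (p i).eval t = (fun l : Fin L => t ^ (l : ℕ)) ⬝ᵥ v i := by
    simp [p, Polynomial.eval_finsetSum, dotProduct, mul_comm]
  rw [Polynomial.eval_sub, eval_p, eval_p, sub_eq_zero]
  exact hij

/-- Powers of an orthogonally diagonalized matrix act diagonally on the transformed side. -/
theorem transpose_mulVec_pow_mulVec {R n : Type*} [CommRing R] [Fintype n] [DecidableEq n]
    {U T : Matrix n n R} {μ : n → R} (hU : Uᵀ * U = 1) (hT : T = U * diagonal μ * Uᵀ)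
    (m : ℕ) (x : n → R) (i : n) :
    (Uᵀ *ᵥ (T ^ m *ᵥ x)) i = μ i ^ m * (Uᵀ *ᵥ x) i := by
  have hcomm : Uᵀ * T = diagonal μ * Uᵀ := by
    rw [hT, ← Matrix.mul_assoc, ← Matrix.mul_assoc, hU, Matrix.one_mul]
  have hpow : Uᵀ * T ^ m = diagonal μ ^ m * Uᵀ := by
    induction m with
    | zero => simp
    | succ k ih =>
      rw [pow_succ, ← Matrix.mul_assoc, ih, Matrix.mul_assoc, hcomm, ← Matrix.mul_assoc, pow_succ]
  rw [mulVec_mulVec, hpow, diagonal_pow, ← mulVec_mulVec, mulVec_diagonal, Pi.pow_apply]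

/-- For every nonempty `Ω ⊆ {1, …, N}` there are `φ₀ ∈ B_Ω` with `φ̂₀(n) ≠ 0 ↔ n ∈ Ω`
and coefficients `d ∈ ℝ^L` such that, with `T = ∑ l, d l • S l`, the bandlimited space
satisfies `B_Ω = span{T^m φ₀ : 0 ≤ m ≤ #Ω − 1}`. -/
theorem stmt6 {N L : ℕ} (hN : 1 ≤ N) (hL : 1 ≤ L)
    (S : Fin L → Matrix (Fin N) (Fin N) ℝ)
    (U : Matrix (Fin N) (Fin N) ℝ)
    (lam : Fin L → Fin N → ℝ)
    (hsymm : ∀ l, (S l)ᵀ = S l)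
    (hcomm : ∀ l l', S l * S l' = S l' * S l)
    (hU : Uᵀ * U = 1 ∧ U * Uᵀ = 1)
    (hdiag : ∀ l, S l = U * Matrix.diagonal (lam l) * Uᵀ)
    (hspec : ∀ n m : Fin N, (∀ l, lam l n = lam l m) → n = m)
    (Ω : Finset (Fin N)) (hΩ : Ω.Nonempty) :
    ∃ (φ₀ : Fin N → ℝ) (d : Fin L → ℝ),
      (∀ n, (Uᵀ *ᵥ φ₀) n ≠ 0 ↔ n ∈ Ω) ∧
      (∀ x : Fin N → ℝ,
        (∀ n ∉ Ω, (Uᵀ *ᵥ x) n = 0) ↔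
          x ∈ Submodule.span ℝ
            {v | ∃ m : ℕ, m ≤ Ω.card - 1 ∧ v = ((∑ l, d l • S l) ^ m) *ᵥ φ₀}) := by
  obtain ⟨d, hd⟩ := exists_injective_dotProduct (v := fun n l => lam l n)
    fun n m h => hspec n m fun l => congrFun h l
  set μ : Fin N → ℝ := fun n => d ⬝ᵥ fun l => lam l n with hμ
  set T := ∑ l, d l • S l with hTdef
  have hT : T = U * diagonal μ * Uᵀ := by
    have hsum : diagonal μ = ∑ l, d l • diagonal (lam l) := by
      ext i j
      by_cases hij : i = j <;> simp [hμ, dotProduct, Matrix.sum_apply, hij]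
    simp [hTdef, hsum, hdiag, Matrix.mul_sum, Matrix.sum_mul]
  let e : Fin N → ℝ := fun n => if n ∈ Ω then 1 else 0
  have hφ : Uᵀ *ᵥ (U *ᵥ e) = e := by rw [mulVec_mulVec, hU.1, one_mulVec]
  have hpow (m : ℕ) (n : Fin N) : (Uᵀ *ᵥ (T ^ m *ᵥ (U *ᵥ e))) n = μ n ^ m * e n := by
    rw [transpose_mulVec_pow_mulVec hU.1 hT, hφ]
  refine ⟨U *ᵥ e, d, fun n => by simp [hφ, e], fun x => ⟨fun hx => ?_, fun hx => ?_⟩⟩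
  · let r := Lagrange.interpolate Ω μ (Uᵀ *ᵥ x)
    have hr : r.natDegree < Ω.card := by
      by_cases h0 : r = 0
      · simpa [h0] using hΩ
      · exact (Polynomial.natDegree_lt_iff_degree_lt h0).2
          (Lagrange.degree_interpolate_lt _ hd.injOn)
    have hxr : x = ∑ m ∈ Finset.range Ω.card, r.coeff m • (T ^ m *ᵥ (U *ᵥ e)) := by
      refine Function.LeftInverse.injective (g := fun y => U *ᵥ y) (f := fun y => Uᵀ *ᵥ y)
        (fun y => by simp [hU.2]) (funext fun n => ?_)
      simp only [mulVec_sum, mulVec_smul, Finset.sum_apply, Pi.smul_apply, hpow, smul_eq_mul]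
      by_cases hn : n ∈ Ω
      · have hev : r.eval (μ n) = (Uᵀ *ᵥ x) n := Lagrange.eval_interpolate_at_node _ hd.injOn hn
        rw [← hev, Polynomial.eval_eq_sum_range' hr]
        simp [e, hn]
      · simp [e, hn, hx n hn]
    rw [hxr]
    exact Submodule.sum_mem _ fun m hm => Submodule.smul_mem _ _ <| Submodule.subset_span
      ⟨m, Nat.le_sub_one_of_lt (Finset.mem_range.1 hm), rfl⟩
  · intro n hn
    induction hx using Submodule.span_induction with
    | mem v hv =>
      obtain ⟨m, -, rfl⟩ := hv
      exact (hpow m n).trans (by simp [e, hn])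
    | zero => simp
    | add v w _ _ hv hw => simp [mulVec_add, hv, hw]
    | smul c v _ hv => simp [mulVec_smul, hv]
end

section
/- Let φ₀ ∈ ℝ^N be nonzero, let H = H({φ₀}) be the principal graph shift-invariant space generated by φ₀, and let M ≥ dim H. Define the matrix F̂_{M,φ₀} = [(λ(n))^α φ̂₀(n)]_{1 ≤ n ≤ N, α ∈ Σ_{M−1}}, where (λ(n))^α = (λ_1(n))^{α_1}⋯(λ_L(n))^{α_L}. Then for every x ∈ H, σ_min⁺(F̂_{M,φ₀}) ‖x‖₂ ≤ (Σ_{α ∈ Σ_{M−1}} |⟨x, S^α φ₀⟩|²)^{1/2} ≤ σ_max(F̂_{M,φ₀}) ‖x‖₂, where σ_min⁺ denotes the minimal nonzero singular value, σ_max the maximal singular value, and ⟨·,·⟩ the standard Euclidean inner product. -/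
open Matrix

/-- The principal graph shift-invariant space generated by `φ₀`. -/
def PGSIS {N L : ℕ} (S : Fin L → Matrix (Fin N) (Fin N) ℝ) (φ₀ : Fin N → ℝ) :
    Submodule ℝ (Fin N → ℝ) :=
  Submodule.span ℝ {v | ∃ α : Fin L → ℕ, v = Spow S α *ᵥ φ₀}

/-- The Euclidean (ℓ²) norm of a vector. -/
noncomputable def norm2 {n : Type*} [Fintype n] (x : n → ℝ) : ℝ :=
  Real.sqrt (∑ i, x i ^ 2)

/-- The maximal singular value of a matrix: the supremum of `‖A c‖₂` over unit vectors. -/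
noncomputable def sigmaMax {m n : Type*} [Fintype m] [Fintype n]
    (A : Matrix m n ℝ) : ℝ :=
  sSup {r | ∃ c : n → ℝ, norm2 c = 1 ∧ r = norm2 (A *ᵥ c)}

/-- The minimal nonzero singular value of a matrix: the infimum of `‖A c‖₂` over unit
vectors orthogonal to the kernel of `A`. -/
noncomputable def sigmaMinPos {m n : Type*} [Fintype m] [Fintype n]
    (A : Matrix m n ℝ) : ℝ :=
  sInf {r | ∃ c : n → ℝ, norm2 c = 1 ∧ (∀ k : n → ℝ, A *ᵥ k = 0 → c ⬝ᵥ k = 0) ∧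
    r = norm2 (A *ᵥ c)}

/-- The index set `Σ_{M−1} = {α ∈ ℤ₊^L : α₁ + ⋯ + α_L ≤ M − 1}` (each component is then
necessarily `< M`). -/
def SigmaIdx (L M : ℕ) : Type :=
  {α : Fin L → Fin M // (∑ l, (α l : ℕ)) ≤ M - 1}

instance (L M : ℕ) : Fintype (SigmaIdx L M) := by
  unfold SigmaIdx; infer_instance

section EuclideanNorm

/-- Every vector has the same image under `A` as some vector orthogonal to the kernel of `A`. -/
lemma exists_mulVec_eq_and_orthogonal_ker {m n : Type*} [Fintype n] (A : Matrix m n ℝ)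
    (c : n → ℝ) :
    ∃ d : n → ℝ, A *ᵥ d = A *ᵥ c ∧ ∀ k : n → ℝ, A *ᵥ k = 0 → d ⬝ᵥ k = 0 := by
  let K : Submodule ℝ (EuclideanSpace ℝ n) :=
    (LinearMap.ker A.mulVecLin).comap (WithLp.linearEquiv 2 ℝ (n → ℝ)).toLinearMap
  obtain ⟨y, hy, z, hz, h⟩ := K.exists_add_mem_mem_orthogonal (WithLp.toLp 2 c)
  have hy0 : A *ᵥ y.ofLp = 0 := hy
  have hc : c = y.ofLp + z.ofLp := congrArg WithLp.ofLp h
  refine ⟨z.ofLp, by rw [hc, mulVec_add, hy0, zero_add], fun k hk => ?_⟩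
  have hkK : WithLp.toLp 2 k ∈ K := hk
  have := (Submodule.mem_orthogonal K z).1 hz _ hkK
  simpa [EuclideanSpace.inner_eq_star_dotProduct] using this

variable {m n : Type*} [Fintype m] [Fintype n]

lemma norm2_nonneg (x : n → ℝ) : 0 ≤ norm2 x := Real.sqrt_nonneg _

lemma norm2_sq (x : n → ℝ) : norm2 x ^ 2 = x ⬝ᵥ x := by
  rw [norm2, Real.sq_sqrt (Finset.sum_nonneg fun _ _ => sq_nonneg _)]
  simp [dotProduct, sq]

lemma norm2_eq_zero {x : n → ℝ} : norm2 x = 0 ↔ x = 0 := by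
  rw [← sq_eq_zero_iff, norm2_sq, dotProduct_self_eq_zero]

lemma norm2_smul (a : ℝ) (x : n → ℝ) : norm2 (a • x) = |a| * norm2 x := by
  simp [norm2, mul_pow, ← Finset.mul_sum, Real.sqrt_mul (sq_nonneg a), Real.sqrt_sq_eq_abs]

lemma norm2_inv_smul_self {x : n → ℝ} (hx : norm2 x ≠ 0) : norm2 ((norm2 x)⁻¹ • x) = 1 := by
  rw [norm2_smul, abs_of_nonneg (inv_nonneg.2 (norm2_nonneg x)), inv_mul_cancel₀ hx]

lemma dotProduct_le_norm2_mul_norm2 (x y : n → ℝ) : x ⬝ᵥ y ≤ norm2 x * norm2 y :=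
  Real.sum_mul_le_sqrt_mul_sqrt _ x y

lemma norm2_mulVec_le_frobenius (A : Matrix m n ℝ) (c : n → ℝ) :
    norm2 (A *ᵥ c) ≤ Real.sqrt (∑ i, ∑ j, A i j ^ 2) * norm2 c := by
  rw [norm2, norm2, ← Real.sqrt_mul (by positivity), Finset.sum_mul]
  exact Real.sqrt_le_sqrt (Finset.sum_le_sum fun i _ => Finset.sum_mul_sq_le_sq_mul_sq _ (A i) c)

lemma norm2_mulVec_inv_smul (A : Matrix m n ℝ) (c : n → ℝ) :
    norm2 (A *ᵥ ((norm2 c)⁻¹ • c)) = (norm2 c)⁻¹ * norm2 (A *ᵥ c) := by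
  rw [mulVec_smul, norm2_smul, abs_of_nonneg (inv_nonneg.2 (norm2_nonneg c))]

lemma norm2_mulVec_le_sigmaMax_mul (A : Matrix m n ℝ) (c : n → ℝ) :
    norm2 (A *ᵥ c) ≤ sigmaMax A * norm2 c := by
  by_cases hc : norm2 c = 0
  · rw [norm2_eq_zero.1 hc, mulVec_zero, norm2_eq_zero.2 rfl, norm2_eq_zero.2 rfl, mul_zero]
  have hpos : 0 < norm2 c := lt_of_le_of_ne (norm2_nonneg c) (Ne.symm hc)
  have hbdd : BddAbove {r | ∃ c : n → ℝ, norm2 c = 1 ∧ r = norm2 (A *ᵥ c)} := by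
    refine ⟨Real.sqrt (∑ i, ∑ j, A i j ^ 2), ?_⟩
    rintro r ⟨d, hd, rfl⟩
    simpa [hd] using norm2_mulVec_le_frobenius A d
  have h : norm2 (A *ᵥ ((norm2 c)⁻¹ • c)) ≤ sigmaMax A :=
    le_csSup hbdd ⟨_, norm2_inv_smul_self hc, rfl⟩
  rwa [norm2_mulVec_inv_smul, inv_mul_le_iff₀ hpos, mul_comm] at h

lemma sigmaMinPos_mul_le_norm2_mulVec (A : Matrix m n ℝ) (c : n → ℝ)
    (horth : ∀ k : n → ℝ, A *ᵥ k = 0 → c ⬝ᵥ k = 0) :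
    sigmaMinPos A * norm2 c ≤ norm2 (A *ᵥ c) := by
  by_cases hc : norm2 c = 0
  · rw [hc, mul_zero]
    exact norm2_nonneg _
  have hpos : 0 < norm2 c := lt_of_le_of_ne (norm2_nonneg c) (Ne.symm hc)
  have hbdd : BddBelow {r | ∃ c : n → ℝ, norm2 c = 1 ∧
      (∀ k : n → ℝ, A *ᵥ k = 0 → c ⬝ᵥ k = 0) ∧ r = norm2 (A *ᵥ c)} := by
    refine ⟨0, ?_⟩
    rintro r ⟨d, -, -, rfl⟩
    exact norm2_nonneg _
  have h : sigmaMinPos A ≤ norm2 (A *ᵥ ((norm2 c)⁻¹ • c)) :=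
    csInf_le hbdd ⟨_, norm2_inv_smul_self hc,
      fun k hk => by rw [smul_dotProduct, horth k hk, smul_zero], rfl⟩
  rwa [norm2_mulVec_inv_smul, le_inv_mul_iff₀ hpos, mul_comm] at h

lemma norm2_mulVec_transpose_le (A : Matrix m n ℝ) (y : m → ℝ) :
    norm2 (Aᵀ *ᵥ y) ≤ sigmaMax A * norm2 y := by
  by_cases hz : norm2 (Aᵀ *ᵥ y) = 0
  · rw [hz]
    refine mul_nonneg (Real.sSup_nonneg ?_) (norm2_nonneg y)
    rintro r ⟨d, -, rfl⟩
    exact norm2_nonneg _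
  have hpos : 0 < norm2 (Aᵀ *ᵥ y) := lt_of_le_of_ne (norm2_nonneg _) (Ne.symm hz)
  refine le_of_mul_le_mul_right ?_ hpos
  calc norm2 (Aᵀ *ᵥ y) * norm2 (Aᵀ *ᵥ y) = (A *ᵥ (Aᵀ *ᵥ y)) ⬝ᵥ y := by
        rw [← sq, norm2_sq, dotProduct_mulVec, vecMul_transpose]
    _ ≤ norm2 (A *ᵥ (Aᵀ *ᵥ y)) * norm2 y := dotProduct_le_norm2_mul_norm2 _ _
    _ ≤ sigmaMax A * norm2 (Aᵀ *ᵥ y) * norm2 y :=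
        mul_le_mul_of_nonneg_right (norm2_mulVec_le_sigmaMax_mul A _) (norm2_nonneg y)
    _ = sigmaMax A * norm2 y * norm2 (Aᵀ *ᵥ y) := by ring

lemma sigmaMinPos_mul_le_norm2_transpose_mulVec (A : Matrix m n ℝ) (c : n → ℝ) :
    sigmaMinPos A * norm2 (A *ᵥ c) ≤ norm2 (Aᵀ *ᵥ (A *ᵥ c)) := by
  obtain ⟨d, hd, horth⟩ := exists_mulVec_eq_and_orthogonal_ker A c
  rw [← hd]
  by_cases hy : norm2 (A *ᵥ d) = 0
  · rw [hy, mul_zero]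
    exact norm2_nonneg _
  have hpos : 0 < norm2 (A *ᵥ d) := lt_of_le_of_ne (norm2_nonneg _) (Ne.symm hy)
  have hσ : 0 ≤ sigmaMinPos A := by
    refine Real.sInf_nonneg ?_
    rintro r ⟨e, -, -, rfl⟩
    exact norm2_nonneg _
  refine le_of_mul_le_mul_right ?_ hpos
  calc sigmaMinPos A * norm2 (A *ᵥ d) * norm2 (A *ᵥ d)
      = sigmaMinPos A * ((Aᵀ *ᵥ (A *ᵥ d)) ⬝ᵥ d) := by
        rw [mul_assoc, ← sq, norm2_sq, dotProduct_mulVec, ← mulVec_transpose]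
    _ ≤ sigmaMinPos A * (norm2 (Aᵀ *ᵥ (A *ᵥ d)) * norm2 d) :=
        mul_le_mul_of_nonneg_left (dotProduct_le_norm2_mul_norm2 _ _) hσ
    _ = norm2 (Aᵀ *ᵥ (A *ᵥ d)) * (sigmaMinPos A * norm2 d) := by ring
    _ ≤ norm2 (Aᵀ *ᵥ (A *ᵥ d)) * norm2 (A *ᵥ d) :=
        mul_le_mul_of_nonneg_left (sigmaMinPos_mul_le_norm2_mulVec A d horth) (norm2_nonneg _)

lemma dotProduct_transpose_mulVec_of_orthogonal [DecidableEq n] {U : Matrix n n ℝ}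
    (hU : U * Uᵀ = 1) (x y : n → ℝ) : (Uᵀ *ᵥ x) ⬝ᵥ (Uᵀ *ᵥ y) = x ⬝ᵥ y := by
  rw [dotProduct_mulVec, vecMul_transpose, mulVec_mulVec, hU, one_mulVec]

lemma norm2_transpose_mulVec_of_orthogonal [DecidableEq n] {U : Matrix n n ℝ} (hU : U * Uᵀ = 1)
    (x : n → ℝ) : norm2 (Uᵀ *ᵥ x) = norm2 x := by
  rw [← sq_eq_sq₀ (norm2_nonneg _) (norm2_nonneg _), norm2_sq, norm2_sq,
    dotProduct_transpose_mulVec_of_orthogonal hU]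

end EuclideanNorm

section ShiftInvariantSpace

variable {N L : ℕ}

lemma conj_diagonal_mul_conj_diagonal {U : Matrix (Fin N) (Fin N) ℝ} (hU : Uᵀ * U = 1)
    (d e : Fin N → ℝ) :
    U * diagonal d * Uᵀ * (U * diagonal e * Uᵀ) = U * diagonal (d * e) * Uᵀ := by
  have h : diagonal (d * e) = diagonal d * diagonal e := (diagonal_mul_diagonal d e).symm
  rw [h]
  calc U * diagonal d * Uᵀ * (U * diagonal e * Uᵀ)
      = U * diagonal d * (Uᵀ * U) * diagonal e * Uᵀ := by simp only [Matrix.mul_assoc]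
    _ = U * (diagonal d * diagonal e) * Uᵀ := by
        rw [hU]
        simp only [Matrix.mul_assoc, Matrix.mul_one]

lemma conj_diagonal_pow {U : Matrix (Fin N) (Fin N) ℝ} (hU : Uᵀ * U = 1 ∧ U * Uᵀ = 1)
    (d : Fin N → ℝ) (k : ℕ) :
    (U * diagonal d * Uᵀ) ^ k = U * diagonal (d ^ k) * Uᵀ := by
  induction k with
  | zero => simp [hU.2]
  | succ k ih => rw [pow_succ, ih, conj_diagonal_mul_conj_diagonal hU.1, ← pow_succ]

lemma Spow_eq_conj_diagonal {S : Fin L → Matrix (Fin N) (Fin N) ℝ}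
    {U : Matrix (Fin N) (Fin N) ℝ} {lam : Fin L → Fin N → ℝ}
    (hU : Uᵀ * U = 1 ∧ U * Uᵀ = 1) (hdiag : ∀ l, S l = U * diagonal (lam l) * Uᵀ)
    (α : Fin L → ℕ) :
    Spow S α = U * diagonal (∏ l, lam l ^ α l) * Uᵀ := by
  induction L with
  | zero => simp [Spow, hU.2]
  | succ L ih =>
    have h := ih (S := fun l => S l.succ) (fun l => hdiag l.succ) (fun l => α l.succ)
    rw [Spow] at h ⊢
    rw [List.ofFn_succ, List.prod_cons, h, hdiag, conj_diagonal_pow hU,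
      conj_diagonal_mul_conj_diagonal hU.1, Fin.prod_univ_succ]

/-- The span of the shifts `S^α φ₀` with `α` of total degree at most `k`. -/
def shiftSpan (S : Fin L → Matrix (Fin N) (Fin N) ℝ) (φ₀ : Fin N → ℝ) (k : ℕ) :
    Submodule ℝ (Fin N → ℝ) :=
  Submodule.span ℝ {v | ∃ α : Fin L → ℕ, ∑ l, α l ≤ k ∧ v = Spow S α *ᵥ φ₀}

lemma shiftSpan_mono (S : Fin L → Matrix (Fin N) (Fin N) ℝ) (φ₀ : Fin N → ℝ) :
    Monotone (shiftSpan S φ₀) := by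
  intro j k hjk
  refine Submodule.span_mono ?_
  rintro v ⟨α, hα, rfl⟩
  exact ⟨α, hα.trans hjk, rfl⟩

lemma shiftSpan_le_PGSIS (S : Fin L → Matrix (Fin N) (Fin N) ℝ) (φ₀ : Fin N → ℝ) (k : ℕ) :
    shiftSpan S φ₀ k ≤ PGSIS S φ₀ := by
  refine Submodule.span_mono ?_
  rintro v ⟨α, -, rfl⟩
  exact ⟨α, rfl⟩

lemma mem_shiftSpan (S : Fin L → Matrix (Fin N) (Fin N) ℝ) (φ₀ : Fin N → ℝ) (k : ℕ) :
    φ₀ ∈ shiftSpan S φ₀ k :=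
  Submodule.subset_span ⟨0, by simp, by simp [Spow]⟩

lemma PGSIS_le_of_invariant {S : Fin L → Matrix (Fin N) (Fin N) ℝ} {φ₀ : Fin N → ℝ}
    {V : Submodule ℝ (Fin N → ℝ)} (hφ₀ : φ₀ ∈ V) (hV : ∀ l, ∀ v ∈ V, S l *ᵥ v ∈ V) :
    PGSIS S φ₀ ≤ V := by
  have hmul : ∀ A B : Matrix (Fin N) (Fin N) ℝ, (∀ v ∈ V, A *ᵥ v ∈ V) → (∀ v ∈ V, B *ᵥ v ∈ V) →
      ∀ v ∈ V, (A * B) *ᵥ v ∈ V := by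
    intro A B hA hB v hv
    rw [← mulVec_mulVec]
    exact hA _ (hB v hv)
  have hone : ∀ v ∈ V, (1 : Matrix (Fin N) (Fin N) ℝ) *ᵥ v ∈ V := by simp
  refine Submodule.span_le.2 ?_
  rintro v ⟨α, rfl⟩
  refine List.prod_induction (fun A => ∀ v ∈ V, A *ᵥ v ∈ V) hmul hone ?_ φ₀ hφ₀
  intro A hA
  obtain ⟨l, rfl⟩ := List.mem_ofFn.1 hA
  induction α l with
  | zero => simp
  | succ k ih => rw [pow_succ]; exact hmul _ _ ih (hV l)

lemma mul_Spow {S : Fin L → Matrix (Fin N) (Fin N) ℝ}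
    {U : Matrix (Fin N) (Fin N) ℝ} {lam : Fin L → Fin N → ℝ}
    (hU : Uᵀ * U = 1 ∧ U * Uᵀ = 1) (hdiag : ∀ l, S l = U * diagonal (lam l) * Uᵀ)
    (α : Fin L → ℕ) (l : Fin L) :
    S l * Spow S α = Spow S (Pi.single l 1 + α) := by
  have h : ∏ j, lam j ^ (Pi.single l 1 : Fin L → ℕ) j = lam l := by
    rw [Finset.prod_eq_single l] <;> simp +contextual
  simp only [Spow_eq_conj_diagonal hU hdiag, Pi.add_apply, pow_add, Finset.prod_mul_distrib, h]
  rw [hdiag, conj_diagonal_mul_conj_diagonal hU.1]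

lemma mulVec_mem_shiftSpan_succ {S : Fin L → Matrix (Fin N) (Fin N) ℝ}
    {U : Matrix (Fin N) (Fin N) ℝ} {lam : Fin L → Fin N → ℝ}
    (hU : Uᵀ * U = 1 ∧ U * Uᵀ = 1) (hdiag : ∀ l, S l = U * diagonal (lam l) * Uᵀ)
    {φ₀ : Fin N → ℝ} {k : ℕ} (l : Fin L) {v : Fin N → ℝ} (hv : v ∈ shiftSpan S φ₀ k) :
    S l *ᵥ v ∈ shiftSpan S φ₀ (k + 1) := by
  suffices shiftSpan S φ₀ k ≤ (shiftSpan S φ₀ (k + 1)).comap (S l).mulVecLin from this hv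
  refine Submodule.span_le.2 ?_
  rintro v ⟨α, hα, rfl⟩
  refine Submodule.subset_span ⟨Pi.single l 1 + α, ?_, ?_⟩
  · simp only [Pi.add_apply, Finset.sum_add_distrib, Finset.sum_pi_single', Finset.mem_univ, if_true]
    omega
  · rw [← mul_Spow hU hdiag, mulVecLin_apply, mulVec_mulVec]

lemma PGSIS_le_shiftSpan_or_lt_finrank {S : Fin L → Matrix (Fin N) (Fin N) ℝ}
    {U : Matrix (Fin N) (Fin N) ℝ} {lam : Fin L → Fin N → ℝ}
    (hU : Uᵀ * U = 1 ∧ U * Uᵀ = 1) (hdiag : ∀ l, S l = U * diagonal (lam l) * Uᵀ)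
    {φ₀ : Fin N → ℝ} (hφ₀ : φ₀ ≠ 0) (k : ℕ) :
    PGSIS S φ₀ ≤ shiftSpan S φ₀ k ∨ k < Module.finrank ℝ (shiftSpan S φ₀ k) := by
  induction k with
  | zero =>
    right
    exact Module.finrank_pos_iff_exists_ne_zero.2
      ⟨⟨φ₀, mem_shiftSpan S φ₀ 0⟩, fun h => hφ₀ (congrArg Subtype.val h)⟩
  | succ k ih =>
    have hle : shiftSpan S φ₀ k ≤ shiftSpan S φ₀ (k + 1) := shiftSpan_mono S φ₀ k.le_succ
    rcases ih with h | h
    · exact Or.inl (h.trans hle)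
    rcases hle.eq_or_lt with heq | hlt
    · left
      refine PGSIS_le_of_invariant (mem_shiftSpan S φ₀ _) fun l v hv => ?_
      exact mulVec_mem_shiftSpan_succ hU hdiag l (heq ▸ hv)
    · have := Submodule.finrank_lt_finrank_of_lt hlt
      right
      omega

lemma PGSIS_le_shiftSpan {S : Fin L → Matrix (Fin N) (Fin N) ℝ}
    {U : Matrix (Fin N) (Fin N) ℝ} {lam : Fin L → Fin N → ℝ}
    (hU : Uᵀ * U = 1 ∧ U * Uᵀ = 1) (hdiag : ∀ l, S l = U * diagonal (lam l) * Uᵀ)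
    {φ₀ : Fin N → ℝ} (hφ₀ : φ₀ ≠ 0) {k : ℕ} (hk : Module.finrank ℝ (PGSIS S φ₀) ≤ k + 1) :
    PGSIS S φ₀ ≤ shiftSpan S φ₀ k := by
  rcases PGSIS_le_shiftSpan_or_lt_finrank hU hdiag hφ₀ k with h | h
  · exact h
  · exact (Submodule.eq_of_le_of_finrank_le (shiftSpan_le_PGSIS S φ₀ k) (by omega)).ge

lemma transpose_mulVec_Spow_mulVec {S : Fin L → Matrix (Fin N) (Fin N) ℝ}
    {U : Matrix (Fin N) (Fin N) ℝ} {lam : Fin L → Fin N → ℝ}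
    (hU : Uᵀ * U = 1 ∧ U * Uᵀ = 1) (hdiag : ∀ l, S l = U * diagonal (lam l) * Uᵀ)
    (φ₀ : Fin N → ℝ) (α : Fin L → ℕ) (n : Fin N) :
    (Uᵀ *ᵥ (Spow S α *ᵥ φ₀)) n = (∏ l, lam l n ^ α l) * (Uᵀ *ᵥ φ₀) n := by
  rw [Spow_eq_conj_diagonal hU hdiag, mulVec_mulVec, Matrix.mul_assoc, ← Matrix.mul_assoc Uᵀ, hU.1,
    Matrix.one_mul, ← mulVec_mulVec, mulVec_diagonal]
  simp

end ShiftInvariantSpace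

/-- Frame bounds: the minimal nonzero and the maximal singular values of
`F̂_{M,φ₀} = [λ(n)^α φ̂₀(n)]_{1 ≤ n ≤ N, α ∈ Σ_{M−1}}` are lower and upper frame bounds
for the frame `{S^α φ₀ : α ∈ Σ_{M−1}}` of `H(φ₀)` whenever `M ≥ dim H(φ₀)`. -/
theorem stmt11 {N L : ℕ} (hN : 1 ≤ N) (hL : 1 ≤ L)
    (S : Fin L → Matrix (Fin N) (Fin N) ℝ)
    (U : Matrix (Fin N) (Fin N) ℝ)
    (lam : Fin L → Fin N → ℝ)
    (hsymm : ∀ l, (S l)ᵀ = S l)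
    (hcomm : ∀ l l', S l * S l' = S l' * S l)
    (hU : Uᵀ * U = 1 ∧ U * Uᵀ = 1)
    (hdiag : ∀ l, S l = U * Matrix.diagonal (lam l) * Uᵀ)
    (hspec : ∀ n m : Fin N, (∀ l, lam l n = lam l m) → n = m)
    (φ₀ : Fin N → ℝ) (hφ₀ : φ₀ ≠ 0)
    (M : ℕ) (hM : Module.finrank ℝ (PGSIS S φ₀) ≤ M)
    (Fhat : Matrix (Fin N) (SigmaIdx L M) ℝ)
    (hF : ∀ n α, Fhat n α = (∏ l, lam l n ^ ((α.1 l : ℕ))) * (Uᵀ *ᵥ φ₀) n) :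
    ∀ x ∈ PGSIS S φ₀,
      sigmaMinPos Fhat * norm2 x ≤
        Real.sqrt (∑ α : SigmaIdx L M,
          (x ⬝ᵥ (Spow S (fun l => (α.1 l : ℕ)) *ᵥ φ₀)) ^ 2) ∧
      Real.sqrt (∑ α : SigmaIdx L M,
          (x ⬝ᵥ (Spow S (fun l => (α.1 l : ℕ)) *ᵥ φ₀)) ^ 2) ≤
        sigmaMax Fhat * norm2 x := by
  intro x hx
  have hcol : ∀ α : SigmaIdx L M, Uᵀ *ᵥ (Spow S (fun l => (α.1 l : ℕ)) *ᵥ φ₀) = Fhat.col α :=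
    fun α => funext fun n => by
      rw [transpose_mulVec_Spow_mulVec hU hdiag, col_apply, hF]
  have hcoeff : Real.sqrt (∑ α : SigmaIdx L M,
      (x ⬝ᵥ (Spow S (fun l => (α.1 l : ℕ)) *ᵥ φ₀)) ^ 2) = norm2 (Fhatᵀ *ᵥ (Uᵀ *ᵥ x)) := by
    rw [norm2]
    congr 1
    refine Finset.sum_congr rfl fun α _ => ?_
    have : (Fhatᵀ *ᵥ (Uᵀ *ᵥ x)) α = Fhat.col α ⬝ᵥ (Uᵀ *ᵥ x) := rfl
    rw [this, ← hcol, dotProduct_transpose_mulVec_of_orthogonal hU.2, dotProduct_comm]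
  have hrange : ∃ c, Fhat *ᵥ c = Uᵀ *ᵥ x := by
    classical
    have hpos : 0 < Module.finrank ℝ (PGSIS S φ₀) :=
      Module.finrank_pos_iff_exists_ne_zero.2
        ⟨⟨φ₀, shiftSpan_le_PGSIS S φ₀ 0 (mem_shiftSpan S φ₀ 0)⟩,
          fun h => hφ₀ (congrArg Subtype.val h)⟩
    suffices shiftSpan S φ₀ (M - 1) ≤ (LinearMap.range Fhat.mulVecLin).comap Uᵀ.mulVecLin from
      this (PGSIS_le_shiftSpan hU hdiag hφ₀ (by omega) hx)
    refine Submodule.span_le.2 ?_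
    rintro v ⟨α, hα, rfl⟩
    have hlt : ∀ l, α l < M := fun l => by
      have := Finset.single_le_sum (f := α) (fun _ _ => Nat.zero_le _) (Finset.mem_univ l)
      omega
    let β : SigmaIdx L M := ⟨fun l => ⟨α l, hlt l⟩, hα⟩
    exact ⟨Pi.single β 1, (mulVec_single_one Fhat β).trans (hcol β).symm⟩
  obtain ⟨c, hc⟩ := hrange
  rw [hcoeff, ← norm2_transpose_mulVec_of_orthogonal hU.2 x]
  refine ⟨?_, norm2_mulVec_transpose_le Fhat _⟩
  rw [← hc]
  exact sigmaMinPos_mul_le_norm2_transpose_mulVec Fhat c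
end
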